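/- The program Π₅ = {a ∨ b; c ← K a} over atoms {a, b, c} has exactly one G91-world view, namely W = {{a}, {b}}, and the program Π₆ = Π₅ ∪ {⊥ ← not c} has no G91-world view; yet Π₆ has the G11-world view {{a, c}}, which is not a G11-world view of Π₅ (Π₅'s unique G11-world view is {{a}, {b}}). Consequently the G11 semantics does not satisfy the epistemic splitting property. -/

import Mathlib

open scoped Classical

variable {At : Type}

/-! ### Objective literals, rules and programs -/

/-- Objective literals: truth constants, an atom `a`, `not a`, or `not not a`. -/
inductive OLit (At : Type) : Type
  | top : OLit At
  | bot : OLit At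
  | pos (a : At) : OLit At
  | neg (a : At) : OLit At
  | nneg (a : At) : OLit At

namespace OLit

/-- Classical satisfaction of an objective literal by an interpretation `I`
(`not` is read as classical negation). -/
def sat (I : Set At) : OLit At → Prop
  | .top => True
  | .bot => False
  | .pos a => a ∈ I
  | .neg a => a ∉ I
  | .nneg a => a ∈ I

/-- Atoms occurring in an objective literal. -/
def atoms : OLit At → Set At
  | .top => ∅
  | .bot => ∅
  | .pos a => {a}
  | .neg a => {a}
  | .nneg a => {a}

/-- The reduct of a literal w.r.t. `I`: every negated part is replaced by its
truth value w.r.t. `I`. -/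
noncomputable def reduct (I : Set At) : OLit At → OLit At
  | .top => .top
  | .bot => .bot
  | .pos a => .pos a
  | .neg a => if a ∈ I then .bot else .top
  | .nneg a => if a ∈ I then .top else .bot

/-- Replace every atom belonging to `U` by `⊤` if it is in `I` and by `⊥` otherwise. -/
noncomputable def esimp (U I : Set At) : OLit At → OLit At
  | .top => .top
  | .bot => .bot
  | .pos a => if a ∈ U then (if a ∈ I then .top else .bot) else .pos a
  | .neg a => if a ∈ U then (if a ∈ I then .bot else .top) else .neg a
  | .nneg a => if a ∈ U then (if a ∈ I then .top else .bot) else .nneg a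

/-- Default negation `not l` of an objective literal. -/
def negate : OLit At → OLit At
  | .top => .bot
  | .bot => .top
  | .pos a => .neg a
  | .neg a => .nneg a
  | .nneg a => .neg a

end OLit

/-- An objective rule `a₁ ∨ … ∨ aₙ ← L₁, …, Lₘ`. -/
structure ORule (At : Type) : Type where
  head : List At
  body : List (OLit At)

namespace ORule

/-- Classical satisfaction of a rule. -/
def sat (I : Set At) (r : ORule At) : Prop :=
  (∀ L ∈ r.body, L.sat I) → ∃ a ∈ r.head, a ∈ I

/-- The head atoms of a rule, as a set. -/
def headAtoms (r : ORule At) : Set At := {a | a ∈ r.head}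

/-- All atoms occurring in a rule. -/
def atoms (r : ORule At) : Set At := r.headAtoms ∪ ⋃ L ∈ r.body, L.atoms

/-- Reduct of a rule w.r.t. `I`. -/
noncomputable def reduct (I : Set At) (r : ORule At) : ORule At :=
  ⟨r.head, r.body.map (OLit.reduct I)⟩

/-- Replace in the body every atom of `U` by its truth value w.r.t. `I`. -/
noncomputable def esimp (U I : Set At) (r : ORule At) : ORule At :=
  ⟨r.head, r.body.map (OLit.esimp U I)⟩

end ORule

/-- `I` is a classical model of the objective program `P`. -/
def isOModel (I : Set At) (P : Set (ORule At)) : Prop := ∀ r ∈ P, r.sat I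

/-- The reduct `P^I` of an objective program. -/
noncomputable def oReduct (P : Set (ORule At)) (I : Set At) : Set (ORule At) :=
  (ORule.reduct I) '' P

/-- `I` is a stable model of `P`: a ⊆-minimal classical model of `P^I`. -/
def isStable (I : Set At) (P : Set (ORule At)) : Prop :=
  isOModel I (oReduct P I) ∧ ∀ J : Set At, J ⊆ I → isOModel J (oReduct P I) → J = I

/-- `SM[P]`, the set of stable models of `P`. -/
def SMs (P : Set (ORule At)) : Set (Set At) := {I | isStable I P}

/-- `U` is a splitting set of the objective program `P`. -/
def isSplittingSet (U : Set At) (P : Set (ORule At)) : Prop :=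
  ∀ r ∈ P, r.atoms ⊆ U ∨ r.headAtoms ∩ U = ∅

/-- The bottom `b_U(P)`. -/
def oBottom (U : Set At) (P : Set (ORule At)) : Set (ORule At) := {r ∈ P | r.atoms ⊆ U}

/-- The top `t_U(P)`. -/
def oTop (U : Set At) (P : Set (ORule At)) : Set (ORule At) := P \ oBottom U P

/-- Simplify a (top) program by replacing every atom of `U` by its truth value w.r.t. `I`. -/
noncomputable def simpProg (U I : Set At) (T : Set (ORule At)) : Set (ORule At) :=
  (ORule.esimp U I) '' T

/-- `e_U(P, I)`. -/
noncomputable def eU (U : Set At) (P : Set (ORule At)) (I : Set At) : Set (ORule At) :=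
  simpProg U I (oTop U P)

/-- `⟨Ib, It⟩` is a solution of `P` w.r.t. `U`. -/
def isSolution (U : Set At) (P : Set (ORule At)) (Ib It : Set At) : Prop :=
  isStable Ib (oBottom U P) ∧ isStable It (eU U P Ib)

/-- `⟨B, T⟩` is an arbitrary splitting of `P` w.r.t. the splitting set `U`. -/
def isArbSplitting (U : Set At) (P B T : Set (ORule At)) : Prop :=
  B ∩ T = ∅ ∧ B ∪ T = P ∧ (∀ r ∈ B, r.atoms ⊆ U) ∧ (∀ r ∈ T, r.headAtoms ∩ U = ∅)

/-! ### Epistemic specifications -/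

/-- Subjective literals `K l`, `M l`, `not K l`, `not M l`. -/
inductive SLit (At : Type) : Type
  | k (l : OLit At) : SLit At
  | m (l : OLit At) : SLit At
  | notk (l : OLit At) : SLit At
  | notm (l : OLit At) : SLit At

namespace SLit

/-- Satisfaction `W ⊨ L` of a subjective literal by a set of interpretations. -/
def sat (W : Set (Set At)) : SLit At → Prop
  | .k l => ∀ I ∈ W, l.sat I
  | .m l => ∃ I ∈ W, l.sat I
  | .notk l => ¬ ∀ I ∈ W, l.sat I
  | .notm l => ¬ ∃ I ∈ W, l.sat I

/-- Atoms occurring in a subjective literal. -/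
def atoms : SLit At → Set At
  | .k l => l.atoms
  | .m l => l.atoms
  | .notk l => l.atoms
  | .notm l => l.atoms

end SLit

/-- A body literal of an epistemic rule: objective or subjective. -/
inductive ELit (At : Type) : Type
  | obj (l : OLit At) : ELit At
  | sub (L : SLit At) : ELit At

namespace ELit

/-- Atoms occurring in a body literal. -/
def atoms : ELit At → Set At
  | .obj l => l.atoms
  | .sub L => L.atoms

/-- Atoms occurring in a body literal, if it is objective. -/
def objAtoms : ELit At → Set At
  | .obj l => l.atoms
  | .sub _ => ∅

/-- Atoms occurring in a body literal, if it is subjective. -/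
def subAtoms : ELit At → Set At
  | .obj _ => ∅
  | .sub L => L.atoms

/-- The body literal is objective. -/
def isObj : ELit At → Prop
  | .obj _ => True
  | .sub _ => False

/-- Subjective reduct of a body literal w.r.t. `W` and signature `U`. -/
noncomputable def sReduct (W : Set (Set At)) (U : Set At) : ELit At → ELit At
  | .obj l => .obj l
  | .sub L => if L.atoms ⊆ U then (if L.sat W then .obj .top else .obj .bot) else .sub L

/-- Subjective reduct of a body literal w.r.t. `W` for the full signature:
every subjective literal is replaced by its truth value, so the result is objective. -/
noncomputable def fullReduct (W : Set (Set At)) : ELit At → OLit At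
  | .obj l => l
  | .sub L => if L.sat W then .top else .bot

end ELit

/-- An epistemic rule `a₁ ∨ … ∨ aₙ ← L₁, …, Lₘ`. -/
structure ERule (At : Type) : Type where
  head : List At
  body : List (ELit At)

namespace ERule

/-- Head atoms of an epistemic rule. -/
def headAtoms (r : ERule At) : Set At := {a | a ∈ r.head}

/-- All atoms of an epistemic rule. -/
def atoms (r : ERule At) : Set At := r.headAtoms ∪ ⋃ L ∈ r.body, L.atoms

/-- Atoms occurring in objective body literals (`Atoms(Body_obj(r))`). -/
def bodyObjAtoms (r : ERule At) : Set At := ⋃ L ∈ r.body, L.objAtoms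

/-- Atoms occurring in subjective body literals (`Atoms(Body_sub(r))`). -/
def bodySubAtoms (r : ERule At) : Set At := ⋃ L ∈ r.body, L.subAtoms

/-- The rule is objective: no subjective literal occurs in it. -/
def isObjective (r : ERule At) : Prop := ∀ L ∈ r.body, L.isObj

/-- The rule is a subjective constraint: empty head and only subjective body literals. -/
def isSubjConstraint (r : ERule At) : Prop := r.head = [] ∧ ∀ L ∈ r.body, ¬ L.isObj

/-- Subjective reduct `r^W_U` of an epistemic rule. -/
noncomputable def sReduct (W : Set (Set At)) (U : Set At) (r : ERule At) : ERule At :=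
  ⟨r.head, r.body.map (ELit.sReduct W U)⟩

/-- Subjective reduct `r^W` for the full signature, as an objective rule. -/
noncomputable def fullReduct (W : Set (Set At)) (r : ERule At) : ORule At :=
  ⟨r.head, r.body.map (ELit.fullReduct W)⟩

end ERule

/-- Subjective reduct `P^W_U` of an epistemic program. -/
noncomputable def esReduct (P : Set (ERule At)) (W : Set (Set At)) (U : Set At) :
    Set (ERule At) :=
  (ERule.sReduct W U) '' P

/-- Subjective reduct `P^W` (full signature), as an objective program. -/
noncomputable def eFullReduct (P : Set (ERule At)) (W : Set (Set At)) : Set (ORule At) :=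
  (ERule.fullReduct W) '' P

/-- Projection `W|_V` of a set of interpretations to the atoms in `V`. -/
def proj (W : Set (Set At)) (V : Set At) : Set (Set At) := (fun I => I ∩ V) '' W

/-- `U` is an epistemic splitting set of `P`. -/
def isEpiSplittingSet (U : Set At) (P : Set (ERule At)) : Prop :=
  ∀ r ∈ P, r.atoms ⊆ U ∨ (r.bodyObjAtoms ∪ r.headAtoms) ∩ U = ∅

/-- `⟨B, T⟩` is a splitting of `P` w.r.t. the epistemic splitting set `U`. -/
def isEpiSplitting (U : Set At) (P B T : Set (ERule At)) : Prop :=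
  B ∩ T = ∅ ∧ B ∪ T = P ∧ (∀ r ∈ B, r.atoms ⊆ U) ∧
    (∀ r ∈ T, (r.bodyObjAtoms ∪ r.headAtoms) ∩ U = ∅)

/-- `W_b ⊔ W_t = { Ib ∪ It : Ib ∈ W_b, It ∈ W_t }`. -/
def squnion (Wb Wt : Set (Set At)) : Set (Set At) :=
  {I | ∃ Ib ∈ Wb, ∃ It ∈ Wt, I = Ib ∪ It}

/-- G91-world view: a nonempty `W` with `W = SM[P^W]`. -/
def isG91WorldView (W : Set (Set At)) (P : Set (ERule At)) : Prop :=
  W.Nonempty ∧ W = SMs (eFullReduct P W)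

/-! ### Abstract semantics and its properties -/

/-- A semantics assigns to every epistemic program a collection of world views. -/
abbrev Semantics (At : Type) : Type := Set (ERule At) → Set (Set (Set At))

/-- The objective program corresponding to an epistemic program without
subjective literals (the subjective reduct is independent of the world view there). -/
noncomputable def toObjProg (P : Set (ERule At)) : Set (ORule At) := eFullReduct P ∅

/-- Supra-ASP: on objective programs, either the unique world view is the nonempty
set of stable models, or there are no stable models and no world view. -/
def SupraASP (S : Semantics At) : Prop :=
  ∀ P : Set (ERule At), (∀ r ∈ P, r.isObjective) →
    ((SMs (toObjProg P) ≠ ∅ ∧ S P = {SMs (toObjProg P)}) ∨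
     (SMs (toObjProg P) = ∅ ∧ S P = ∅))

/-- The epistemic splitting property for a semantics `S`. -/
def EpistemicSplittingProp (S : Semantics At) : Prop :=
  ∀ (U : Set At) (P B T : Set (ERule At)), isEpiSplitting U P B T →
    ∀ W : Set (Set At),
      W ∈ S P ↔ ∃ Wb ∈ S B, ∃ Wt ∈ S (esReduct T Wb U), W = squnion Wb Wt

/-- Modal dependence relation `dep(a, b)`. -/
def dep (P : Set (ERule At)) (a b : At) : Prop :=
  ∃ r ∈ P, a ∈ r.headAtoms ∪ r.bodyObjAtoms ∧ b ∈ r.bodySubAtoms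

/-- `P` is epistemically stratified. -/
def EpistemicallyStratified (P : Set (ERule At)) : Prop :=
  ∃ lam : At → ℕ,
    (∀ r ∈ P, ∀ a ∈ r.atoms \ r.bodySubAtoms, ∀ b ∈ r.atoms \ r.bodySubAtoms,
        lam a = lam b) ∧
    (∀ a b : At, dep P a b → lam b < lam a)

/-- `W ⊨ r` for a subjective constraint `r`: some subjective body literal fails in `W`. -/
def wvSatConstraint (W : Set (Set At)) (r : ERule At) : Prop :=
  ∃ L ∈ r.body, ∃ s : SLit At, L = ELit.sub s ∧ ¬ s.sat W

/-- Subjective constraint monotonicity for a semantics `S`. -/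
def SubjConstraintMonotonicity (S : Semantics At) : Prop :=
  ∀ (P : Set (ERule At)) (r : ERule At), r.isSubjConstraint →
    ∀ W : Set (Set At), W.Nonempty →
      (W ∈ S (P ∪ {r}) ↔ W ∈ S P ∧ wvSatConstraint W r)

/-! ### The G11 semantics -/

/-- G11-reduct of a body literal: `K l` is replaced by `l` when `W ⊨ K l` and by `⊥`
otherwise; the remaining subjective literals are replaced by their truth value. -/
noncomputable def ELit.g11Reduct (W : Set (Set At)) : ELit At → OLit At
  | .obj l => l
  | .sub (.k l) => if (SLit.k l).sat W then l else OLit.bot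
  | .sub (.notk l) => if (SLit.notk l).sat W then OLit.top else OLit.bot
  | .sub (.m l) => if (SLit.m l).sat W then OLit.top else OLit.bot
  | .sub (.notm l) => if (SLit.notm l).sat W then OLit.top else OLit.bot

/-- G11-reduct of a program. -/
noncomputable def g11Reduct (P : Set (ERule At)) (W : Set (Set At)) : Set (ORule At) :=
  (fun r : ERule At => (⟨r.head, r.body.map (ELit.g11Reduct W)⟩ : ORule At)) '' P

/-- G11-world view. -/
def isG11WorldView (W : Set (Set At)) (P : Set (ERule At)) : Prop :=
  W.Nonempty ∧ W = SMs (g11Reduct P W)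

/-! ### The K15 and S17 semantics -/

/-- K15-reduct of a body literal: occurrences of `K l` with `W ⊭ K l` become `⊥`,
all other occurrences of `K l` are replaced by `l` (so `not K l` becomes `not l`
when `W ⊨ K l` and `⊤` otherwise; `M l` is treated as `not K not l`). -/
noncomputable def ELit.k15Reduct (W : Set (Set At)) : ELit At → OLit At
  | .obj l => l
  | .sub (.k l) => if (SLit.k l).sat W then l else OLit.bot
  | .sub (.notk l) => if (SLit.k l).sat W then l.negate else OLit.top
  | .sub (.m l) => if (SLit.k l.negate).sat W then l.negate.negate else OLit.top
  | .sub (.notm l) => if (SLit.k l.negate).sat W then l.negate else OLit.bot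

/-- K15-reduct of a program. -/
noncomputable def k15Reduct (P : Set (ERule At)) (W : Set (Set At)) : Set (ORule At) :=
  (fun r : ERule At => (⟨r.head, r.body.map (ELit.k15Reduct W)⟩ : ORule At)) '' P

/-- K15-world view. -/
def isK15WorldView (W : Set (Set At)) (P : Set (ERule At)) : Prop :=
  W.Nonempty ∧ W = SMs (k15Reduct P W)

/-- The objective literals `l` such that `K l` occurs in `P`. -/
def kLits (P : Set (ERule At)) : Set (OLit At) :=
  {l | ∃ r ∈ P, ∃ L ∈ r.body, L = ELit.sub (SLit.k l) ∨ L = ELit.sub (SLit.notk l)}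

/-- `Φ_W`: the epistemic literals `not K l` of `E_P` satisfied by `W`. -/
def Phi (P : Set (ERule At)) (W : Set (Set At)) : Set (OLit At) :=
  {l ∈ kLits P | (SLit.notk l).sat W}

/-- S17-world view: a K15-world view maximizing the satisfied epistemic negations. -/
def isS17WorldView (W : Set (Set At)) (P : Set (ERule At)) : Prop :=
  isK15WorldView W P ∧
    ¬ ∃ W' : Set (Set At), isK15WorldView W' P ∧ Phi P W ⊂ Phi P W'

/-! ### EHT and the F15 semantics -/

/-- EHT satisfaction of an objective literal at point `I` with "here" mapping `h`. -/
def OLit.ehtSat (h : Set At → Set At) (I : Set At) : OLit At → Prop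
  | .top => True
  | .bot => False
  | .pos a => a ∈ h I
  | .neg a => a ∉ I
  | .nneg a => a ∈ I

/-- EHT satisfaction of a subjective literal. -/
def SLit.ehtSat (W : Set (Set At)) (h : Set At → Set At) : SLit At → Prop
  | .k l => ∀ I' ∈ W, l.ehtSat h I'
  | .m l => ∃ I' ∈ W, l.ehtSat h I'
  | .notk l => ¬ ∀ I' ∈ W, l.ehtSat id I'
  | .notm l => ¬ ∃ I' ∈ W, l.ehtSat id I'

/-- EHT satisfaction of a body literal at point `I`. -/
def ELit.ehtSat (W : Set (Set At)) (h : Set At → Set At) (I : Set At) : ELit At → Prop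
  | .obj l => l.ehtSat h I
  | .sub L => L.ehtSat W h

/-- EHT satisfaction of a rule at point `I`. -/
def ERule.ehtSat (W : Set (Set At)) (h : Set At → Set At) (I : Set At) (r : ERule At) : Prop :=
  (∀ L ∈ r.body, L.ehtSat W h I) → ∃ a ∈ r.head, a ∈ h I

/-- `⟨W, h⟩` is an EHT-model of `P` (with `W` nonempty and `h T ⊆ T` on `W`). -/
def isEHTModel (W : Set (Set At)) (h : Set At → Set At) (P : Set (ERule At)) : Prop :=
  W.Nonempty ∧ (∀ T ∈ W, h T ⊆ T) ∧ ∀ I ∈ W, ∀ r ∈ P, r.ehtSat W h I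

/-- `W` is an equilibrium EHT-model of `P`. -/
def isEquilibriumEHT (W : Set (Set At)) (P : Set (ERule At)) : Prop :=
  isEHTModel W id P ∧
    ¬ ∃ h : Set At → Set At, isEHTModel W h P ∧ ∃ I ∈ W, h I ⊂ I

/-- The auxiliary relation `W, X ⊨* P`. -/
def satStar (W X : Set (Set At)) (P : Set (ERule At)) : Prop :=
  (∀ I ∈ X, ∀ r ∈ P, r.ehtSat W id I) ∧
  (∀ h : Set At → Set At, (∀ T ∈ W, h T ⊆ T) → (∀ T ∈ W \ X, h T = T) →
    (∃ I ∈ W, ∀ r ∈ P, r.ehtSat W h I) → ∀ T ∈ W, h T = T)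

/-- The preference order `W ≤_P W'`. -/
def prefLE (P : Set (ERule At)) (W W' : Set (Set At)) : Prop :=
  ∀ I : Set At, (∃ V : Set (Set At), isEquilibriumEHT V P ∧ I ∈ V) →
    (satStar (W ∪ {I}) W P → satStar (W' ∪ {I}) W' P)

/-- F15-world view: an equilibrium EHT-model maximal w.r.t. `⊂` and `<_P`. -/
def isF15WorldView (W : Set (Set At)) (P : Set (ERule At)) : Prop :=
  isEquilibriumEHT W P ∧
    ¬ ∃ W' : Set (Set At), isEquilibriumEHT W' P ∧
        (W ⊂ W' ∨ (prefLE P W W' ∧ ¬ prefLE P W' W))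

/-! STATEMENT 14: the G11 counterexample. -/

/-- The atoms `a`, `b`, `c`. -/
inductive A3 : Type
  | a : A3
  | b : A3
  | c : A3

/-- The rule `a ∨ b`. -/
def ruleAB : ERule A3 := ⟨[A3.a, A3.b], []⟩

/-- The rule `c ← K a`. -/
def ruleCKA : ERule A3 := ⟨[A3.c], [ELit.sub (SLit.k (OLit.pos A3.a))]⟩

/-- The constraint `⊥ ← not c`. -/
def ruleNotC : ERule A3 := ⟨[], [ELit.obj (OLit.neg A3.c)]⟩

/-- `Π₅ = { a ∨ b ;  c ← K a }`. -/
def P5 : Set (ERule A3) := {ruleAB, ruleCKA}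

/-- `Π₆ = Π₅ ∪ { ⊥ ← not c }`. -/
def P6 : Set (ERule A3) := P5 ∪ {ruleNotC}

/-- The objective program `{ a ∨ b ; c ← L }`, the common shape of the reducts of `Π₅`. -/
def disjProg (L : OLit A3) : Set (ORule A3) := {⟨[A3.a, A3.b], []⟩, ⟨[A3.c], [L]⟩}

/-- The objective constraint `⊥ ← not c`. -/
def constraintC : ORule A3 := ⟨[], [OLit.neg A3.c]⟩

theorem eFullReduct_P5 (W : Set (Set A3)) :
    eFullReduct P5 W =
      disjProg (if (SLit.k (OLit.pos A3.a)).sat W then OLit.top else OLit.bot) := by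
  simp [eFullReduct, P5, Set.image_pair, disjProg, ruleAB, ruleCKA, ERule.fullReduct,
    ELit.fullReduct]

theorem eFullReduct_P6 (W : Set (Set A3)) :
    eFullReduct P6 W = eFullReduct P5 W ∪ {constraintC} := by
  rw [eFullReduct, P6, Set.image_union, Set.image_singleton]
  rfl

theorem g11Reduct_P5 (W : Set (Set A3)) :
    g11Reduct P5 W =
      disjProg (if (SLit.k (OLit.pos A3.a)).sat W then OLit.pos A3.a else OLit.bot) := by
  simp [g11Reduct, P5, Set.image_pair, disjProg, ruleAB, ruleCKA, ELit.g11Reduct]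

theorem g11Reduct_P6 (W : Set (Set A3)) :
    g11Reduct P6 W = g11Reduct P5 W ∪ {constraintC} := by
  rw [g11Reduct, P6, Set.image_union, Set.image_singleton]
  rfl

theorem isOModel_oReduct_disjProg (L : OLit A3) (I J : Set A3) :
    isOModel J (oReduct (disjProg L) I) ↔
      (A3.a ∈ J ∨ A3.b ∈ J) ∧ ((L.reduct I).sat J → A3.c ∈ J) := by
  simp [isOModel, oReduct, disjProg, Set.image_pair, ORule.reduct, ORule.sat]

theorem isOModel_oReduct_constraint (P : Set (ORule A3)) (I J : Set A3) :
    isOModel J (oReduct (P ∪ {constraintC}) I) ↔ isOModel J (oReduct P I) ∧ A3.c ∈ I := by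
  by_cases h : A3.c ∈ I <;>
    simp [isOModel, oReduct, or_imp, forall_and, constraintC, ORule.reduct,
      ORule.sat, OLit.reduct, OLit.sat, h]

theorem SMs_union_constraint (P : Set (ORule A3)) :
    SMs (P ∪ {constraintC}) = {I ∈ SMs P | A3.c ∈ I} := by
  ext I
  simp only [SMs, isStable, Set.mem_ofPred_eq, isOModel_oReduct_constraint]
  tauto

theorem A3.set_ext_iff {I J : Set A3} :
    I = J ↔ (A3.a ∈ I ↔ A3.a ∈ J) ∧ (A3.b ∈ I ↔ A3.b ∈ J) ∧ (A3.c ∈ I ↔ A3.c ∈ J) := by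
  refine ⟨by rintro rfl; simp, fun h => ?_⟩
  ext x
  cases x
  exacts [h.1, h.2.1, h.2.2]

theorem A3.subset_iff {I J : Set A3} :
    I ⊆ J ↔ (A3.a ∈ I → A3.a ∈ J) ∧ (A3.b ∈ I → A3.b ∈ J) ∧ (A3.c ∈ I → A3.c ∈ J) := by
  refine ⟨fun h => ⟨@h _, @h _, @h _⟩, fun h x => ?_⟩
  cases x
  exacts [h.1, h.2.1, h.2.2]

theorem SMs_disjProg_bot : SMs (disjProg OLit.bot) = {{A3.a}, {A3.b}} := by
  ext I
  simp only [SMs, isStable, Set.mem_ofPred_eq, isOModel_oReduct_disjProg, Set.mem_insert_iff,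
    Set.mem_singleton_iff, OLit.reduct, OLit.sat, A3.subset_iff, A3.set_ext_iff]
  constructor
  · rintro ⟨h, hmin⟩
    have ha := hmin {A3.a}
    have hb := hmin {A3.b}
    simp at ha hb ⊢
    tauto
  · simp
    grind

theorem SMs_disjProg_top :
    SMs (disjProg OLit.top) = {{A3.a, A3.c}, {A3.b, A3.c}} := by
  ext I
  simp only [SMs, isStable, Set.mem_ofPred_eq, isOModel_oReduct_disjProg, Set.mem_insert_iff,
    Set.mem_singleton_iff, OLit.reduct, OLit.sat, A3.subset_iff, A3.set_ext_iff]
  constructor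
  · rintro ⟨h, hmin⟩
    have ha := hmin {A3.a, A3.c}
    have hb := hmin {A3.b, A3.c}
    simp at ha hb ⊢
    tauto
  · simp
    grind

theorem SMs_disjProg_pos :
    SMs (disjProg (OLit.pos A3.a)) = {{A3.a, A3.c}, {A3.b}} := by
  ext I
  simp only [SMs, isStable, Set.mem_ofPred_eq, isOModel_oReduct_disjProg, Set.mem_insert_iff,
    Set.mem_singleton_iff, OLit.reduct, OLit.sat, A3.subset_iff, A3.set_ext_iff]
  constructor
  · rintro ⟨h, hmin⟩
    have ha := hmin {A3.a, A3.c}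
    have hb := hmin {A3.b}
    simp at ha hb ⊢
    tauto
  · simp
    grind

theorem isG91WorldView_P5_iff (W : Set (Set A3)) :
    isG91WorldView W P5 ↔ W = {({A3.a} : Set A3), ({A3.b} : Set A3)} := by
  rw [isG91WorldView, eFullReduct_P5]
  split_ifs with h
  · rw [SMs_disjProg_top]
    refine iff_of_false ?_ ?_ <;> [rintro ⟨-, rfl⟩; rintro rfl] <;> simp [SLit.sat, OLit.sat] at h
  · rw [SMs_disjProg_bot]
    exact ⟨And.right, fun hW => ⟨by simp [hW], hW⟩⟩

theorem isG11WorldView_P5_iff (W : Set (Set A3)) :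
    isG11WorldView W P5 ↔ W = {({A3.a} : Set A3), ({A3.b} : Set A3)} := by
  rw [isG11WorldView, g11Reduct_P5]
  split_ifs with h
  · rw [SMs_disjProg_pos]
    refine iff_of_false ?_ ?_ <;> [rintro ⟨-, rfl⟩; rintro rfl] <;> simp [SLit.sat, OLit.sat] at h
  · rw [SMs_disjProg_bot]
    exact ⟨And.right, fun hW => ⟨by simp [hW], hW⟩⟩

theorem not_isG91WorldView_P6 (W : Set (Set A3)) : ¬ isG91WorldView W P6 := by
  rintro ⟨hne, hW⟩
  rw [eFullReduct_P6, SMs_union_constraint, eFullReduct_P5] at hW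
  split_ifs at hW with h
  · rw [SMs_disjProg_top] at hW
    have hb : ({A3.b, A3.c} : Set A3) ∈ W := by simp [hW]
    simpa [OLit.sat] using h _ hb
  · rw [SMs_disjProg_bot] at hW
    obtain ⟨I, hI⟩ := hne
    rw [hW] at hI
    rcases hI with ⟨rfl | rfl, hc⟩ <;> simp at hc

theorem isG11WorldView_P6 : isG11WorldView {({A3.a, A3.c} : Set A3)} P6 := by
  refine ⟨Set.singleton_nonempty _, ?_⟩
  rw [g11Reduct_P6, SMs_union_constraint, g11Reduct_P5,
    if_pos (by simp [SLit.sat, OLit.sat]), SMs_disjProg_pos]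
  ext I
  constructor
  · rintro rfl
    simp
  · rintro ⟨rfl | rfl, hc⟩
    · rfl
    · simp at hc

theorem isEpiSplitting_P6 :
    isEpiSplitting {A3.a, A3.b} P6 {ruleAB} {ruleCKA, ruleNotC} := by
  refine ⟨?_, ?_, ?_, ?_⟩
  · simp [ruleAB, ruleCKA, ruleNotC]
  · simp only [P6, P5]
    grind
  · simp [ruleAB, ERule.atoms, ERule.headAtoms, A3.subset_iff]
  · simp [ruleCKA, ruleNotC, ERule.bodyObjAtoms, ERule.headAtoms, ELit.objAtoms, OLit.atoms]

theorem singleton_b_mem_of_isG11WorldView {W : Set (Set A3)} (h : isG11WorldView W {ruleAB}) :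
    ({A3.b} : Set A3) ∈ W := by
  rw [h.2]
  simp [SMs, isStable, isOModel, oReduct, g11Reduct, ruleAB, ORule.reduct, ORule.sat,
    A3.subset_iff, A3.set_ext_iff]
  tauto

/-- When `K a` fails in the bottom part, `{ c ← K a ; ⊥ ← not c }` has no G11-world view. -/
theorem not_isG11WorldView_top {Wb : Set (Set A3)} (hb : ({A3.b} : Set A3) ∈ Wb)
    (Wt : Set (Set A3)) :
    ¬ isG11WorldView Wt (esReduct {ruleCKA, ruleNotC} Wb {A3.a, A3.b}) := by
  have hK : ¬ (SLit.k (OLit.pos A3.a)).sat Wb := fun h => by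
    simpa [OLit.sat] using h _ hb
  rintro ⟨⟨I, hI⟩, hW⟩
  rw [hW] at hI
  have hred : g11Reduct (esReduct {ruleCKA, ruleNotC} Wb {A3.a, A3.b}) Wt =
      {⟨[A3.c], [OLit.bot]⟩} ∪ {constraintC} := by
    simp [g11Reduct, esReduct, Set.image_pair, ruleCKA, ruleNotC, ERule.sReduct, ELit.sReduct,
      SLit.atoms, OLit.atoms, hK, ELit.g11Reduct, constraintC, Set.pair_comm]
  rw [hred, SMs_union_constraint] at hI
  have hmin := hI.1.2 ∅ (Set.empty_subset I)
    (by simp [isOModel, oReduct, ORule.reduct, ORule.sat, OLit.reduct, OLit.sat])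
  exact Set.notMem_empty A3.c (hmin ▸ hI.2)

/-- `Π₅` has the unique G91-world view `{{a}, {b}}`, `Π₆` has no
G91-world view, yet `{{a, c}}` is a G11-world view of `Π₆` but not of `Π₅` (whose
unique G11-world view is `{{a}, {b}}`); hence G11 does not satisfy epistemic
splitting. -/
theorem g11_fails_epistemic_splitting :
    (∀ W : Set (Set A3),
        isG91WorldView W P5 ↔ W = {({A3.a} : Set A3), ({A3.b} : Set A3)}) ∧
    (∀ W : Set (Set A3), ¬ isG91WorldView W P6) ∧
    isG11WorldView {({A3.a, A3.c} : Set A3)} P6 ∧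
    ¬ isG11WorldView {({A3.a, A3.c} : Set A3)} P5 ∧
    (∀ W : Set (Set A3),
        isG11WorldView W P5 ↔ W = {({A3.a} : Set A3), ({A3.b} : Set A3)}) ∧
    ¬ EpistemicSplittingProp (fun P : Set (ERule A3) => {W | isG11WorldView W P}) := by
  refine ⟨isG91WorldView_P5_iff, not_isG91WorldView_P6, isG11WorldView_P6, ?_,
    isG11WorldView_P5_iff, fun h => ?_⟩
  · rw [isG11WorldView_P5_iff]
    intro h
    have ha : ({A3.b} : Set A3) ∈ ({{A3.a, A3.c}} : Set (Set A3)) := by simp [h]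
    simp [A3.set_ext_iff] at ha
  · obtain ⟨Wb, hWb, Wt, hWt, -⟩ := (h _ _ _ _ isEpiSplitting_P6 _).1 isG11WorldView_P6
    exact not_isG11WorldView_top (singleton_b_mem_of_isG11WorldView hWb) Wt hWt
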